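/- Let λ_n(k) denote the n-th Taylor coefficient at z = 0 of z ↦ Λ_z(k) = 1/(|k|² + 2^{3/2}√(1−z)). For every fixed k ∈ ℝ^d there is a constant K such that for all n ≥ 1: |λ_n(k n^{−1/4}) − (8πn)^{−1/2} Â⁽²⁾(k)| ≤ K n^{−3/2}. -/

import Mathlib

open MeasureTheory Set

noncomputable section

/-- `Λ_z(k) = 1/(|k|² + 2^{3/2}√(1-z))` as a function of the complex variable `z`,
where `a` stands for `|k|²`.  Here `(1-z)^{1/2}` is the principal branch, which has
branch cut `z ∈ [1,∞)` and is positive for real `z < 1`, and `2^{3/2} = 2√2`. -/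
def LambdaC (a : ℝ) (z : ℂ) : ℂ :=
  1 / ((a : ℂ) + ((2 * Real.sqrt 2 : ℝ) : ℂ) * (1 - z) ^ ((1 : ℂ) / 2))

/-- `Λ_z(k)` for `k ∈ ℝ^d`. -/
def Lambda {d : ℕ} (k : Fin d → ℝ) (z : ℂ) : ℂ := LambdaC (∑ i, (k i) ^ 2) z

/-- The `n`-th Taylor coefficient at `z = 0` of an analytic function `f : ℂ → ℂ`. -/
def taylorCoeff (f : ℂ → ℂ) (n : ℕ) : ℂ := iteratedDeriv n f 0 / n.factorial

/-- `Â⁽²⁾(k) = ∫₀^∞ t e^{-t²/2} e^{-|k|²t/2} dt`. -/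
def AhatTwo {d : ℕ} (k : Fin d → ℝ) : ℝ :=
  ∫ t in Ioi (0 : ℝ), t * Real.exp (-t ^ 2 / 2) * Real.exp (-(∑ i, (k i) ^ 2) * t / 2)

/-- The spectral density `x²/(p²+x²)`, extended continuously when `p = 0`. -/
def spectralWeight (p x : ℝ) : ℝ := 1 - p ^ 2 / (p ^ 2 + x ^ 2)

theorem spectralWeight_nonneg (p x : ℝ) : 0 ≤ spectralWeight p x := by
  unfold spectralWeight
  have : p ^ 2 / (p ^ 2 + x ^ 2) ≤ 1 := div_le_one_of_le₀ (by nlinarith [sq_nonneg x]) (by positivity)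
  linarith

theorem spectralWeight_le_one (p x : ℝ) : spectralWeight p x ≤ 1 := by
  unfold spectralWeight
  have : 0 ≤ p ^ 2 / (p ^ 2 + x ^ 2) := by positivity
  linarith

theorem abs_spectralWeight_le_one (p x : ℝ) : |spectralWeight p x| ≤ 1 := by
  rw [abs_of_nonneg (spectralWeight_nonneg p x)]
  exact spectralWeight_le_one p x

@[fun_prop]
theorem measurable_spectralWeight (p : ℝ) : Measurable (spectralWeight p) := by
  unfold spectralWeight
  fun_prop

theorem spectralWeight_div (p x : ℝ) {r : ℝ} (hr : r ≠ 0) :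
    spectralWeight (p / r) (x / r) = spectralWeight p x := by
  unfold spectralWeight
  rw [div_pow, div_pow, ← add_div, div_div_div_cancel_right₀ (pow_ne_zero 2 hr)]

theorem Integrable.spectralWeight_mul {f : ℝ → ℝ} (hf : Integrable f) (p : ℝ) :
    Integrable fun x => spectralWeight p x * f x :=
  hf.bdd_mul (measurable_spectralWeight p).aestronglyMeasurable
    (ae_of_all _ (abs_spectralWeight_le_one p))

theorem inv_sq_add_sq_eq {q : ℝ} (hq : 0 < q) (x : ℝ) :
    (q ^ 2 + x ^ 2)⁻¹ = (q ^ 2)⁻¹ * (1 + (x / q) ^ 2)⁻¹ := by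
  rw [← mul_inv]
  congr 1
  field_simp

theorem integrable_inv_sq_add_sq {q : ℝ} (hq : 0 < q) :
    Integrable fun x : ℝ => (q ^ 2 + x ^ 2)⁻¹ := by
  simp_rw [inv_sq_add_sq_eq hq]
  exact (integrable_inv_one_add_sq.comp_div hq.ne').const_mul _

theorem integral_univ_inv_sq_add_sq {q : ℝ} (hq : 0 < q) :
    ∫ x : ℝ, (q ^ 2 + x ^ 2)⁻¹ = Real.pi / q := by
  simp_rw [inv_sq_add_sq_eq hq]
  rw [integral_const_mul, Measure.integral_comp_div (fun x => (1 + x ^ 2)⁻¹) q,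
    integral_univ_inv_one_add_sq, abs_of_pos hq, smul_eq_mul]
  field_simp

/-- Stieltjes representation of `1/(p+q)`, seen as a function of `q²`. -/
theorem integral_spectralWeight_mul_inv {p q : ℝ} (hp : 0 ≤ p) (hq : 0 < q) (hpq : p ≠ q) :
    ∫ x : ℝ, spectralWeight p x * (q ^ 2 + x ^ 2)⁻¹ = Real.pi / (p + q) := by
  rcases hp.eq_or_lt with rfl | hp
  · simp [spectralWeight, integral_univ_inv_sq_add_sq hq]
  have hd : q ^ 2 - p ^ 2 ≠ 0 := by
    rw [sq_sub_sq]
    exact mul_ne_zero (by positivity) (sub_ne_zero.2 hpq.symm)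
  have h (x : ℝ) : spectralWeight p x * (q ^ 2 + x ^ 2)⁻¹ =
      q ^ 2 / (q ^ 2 - p ^ 2) * (q ^ 2 + x ^ 2)⁻¹ -
        p ^ 2 / (q ^ 2 - p ^ 2) * (p ^ 2 + x ^ 2)⁻¹ := by
    have h1 : p ^ 2 + x ^ 2 ≠ 0 := by positivity
    have h2 : q ^ 2 + x ^ 2 ≠ 0 := by positivity
    unfold spectralWeight
    field_simp
    ring
  simp_rw [h]
  rw [integral_sub ((integrable_inv_sq_add_sq hq).const_mul _)
    ((integrable_inv_sq_add_sq hp).const_mul _), integral_const_mul, integral_const_mul,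
    integral_univ_inv_sq_add_sq hq, integral_univ_inv_sq_add_sq hp]
  have : p + q ≠ 0 := by positivity
  field_simp
  ring

/-- The moments `∫ x²/(p²+x²) (1+x²)^{-(n+1)} dx`. -/
def spectralMoment (p : ℝ) (n : ℕ) : ℝ :=
  ∫ x : ℝ, spectralWeight p x * ((1 + x ^ 2)⁻¹) ^ (n + 1)

theorem inv_one_add_sq_le_one (x : ℝ) : (1 + x ^ 2)⁻¹ ≤ 1 :=
  inv_le_one_of_one_le₀ (by nlinarith [sq_nonneg x])

theorem inv_one_add_sq_pow_succ_le (x : ℝ) (n : ℕ) :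
    ((1 + x ^ 2)⁻¹) ^ (n + 1) ≤ (1 + x ^ 2)⁻¹ :=
  pow_le_of_le_one (by positivity) (inv_one_add_sq_le_one x) n.succ_ne_zero

theorem integrable_inv_one_add_sq_pow_succ (n : ℕ) :
    Integrable fun x : ℝ => ((1 + x ^ 2)⁻¹) ^ (n + 1) := by
  refine integrable_inv_one_add_sq.mono' (by fun_prop) (ae_of_all _ fun x => ?_)
  rw [Real.norm_of_nonneg (by positivity)]
  exact inv_one_add_sq_pow_succ_le x n

theorem spectralMoment_nonneg (p : ℝ) (n : ℕ) : 0 ≤ spectralMoment p n :=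
  integral_nonneg fun x => mul_nonneg (spectralWeight_nonneg p x) (by positivity)

theorem spectralMoment_le_pi (p : ℝ) (n : ℕ) : spectralMoment p n ≤ Real.pi := by
  rw [← integral_univ_inv_one_add_sq]
  refine integral_mono (Integrable.spectralWeight_mul (integrable_inv_one_add_sq_pow_succ n) p)
    integrable_inv_one_add_sq fun x => ?_
  exact (mul_le_of_le_one_left (by positivity) (spectralWeight_le_one p x)).trans
    (inv_one_add_sq_pow_succ_le x n)

theorem hasSum_spectralMoment {p z : ℝ} (hp : 0 ≤ p) (hz : 0 ≤ z) (hz1 : z < 1)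
    (hpz : p ≠ √(1 - z)) :
    HasSum (fun n => spectralMoment p n * z ^ n) (Real.pi / (p + √(1 - z))) := by
  have hq : 0 < √(1 - z) := Real.sqrt_pos.2 (by linarith)
  have hint (n : ℕ) : Integrable fun x : ℝ =>
      spectralWeight p x * ((1 + x ^ 2)⁻¹) ^ (n + 1) * z ^ n :=
    (Integrable.spectralWeight_mul (integrable_inv_one_add_sq_pow_succ n) p).mul_const _
  have hsum : Summable fun n : ℕ =>
      ∫ x : ℝ, ‖spectralWeight p x * ((1 + x ^ 2)⁻¹) ^ (n + 1) * z ^ n‖ := by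
    have heq (n : ℕ) : (∫ x : ℝ, ‖spectralWeight p x * ((1 + x ^ 2)⁻¹) ^ (n + 1) * z ^ n‖) =
        spectralMoment p n * z ^ n := by
      rw [spectralMoment, ← integral_mul_const]
      refine integral_congr_ae (ae_of_all _ fun x => ?_)
      exact Real.norm_of_nonneg (mul_nonneg
        (mul_nonneg (spectralWeight_nonneg p x) (by positivity)) (by positivity))
    simp_rw [heq]
    exact Summable.of_nonneg_of_le
      (fun n => mul_nonneg (spectralMoment_nonneg p n) (by positivity))
      (fun n => mul_le_mul_of_nonneg_right (spectralMoment_le_pi p n) (by positivity))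
      ((summable_geometric_of_lt_one hz hz1).mul_left _)
  have key := hasSum_integral_of_summable_integral_norm hint hsum
  have htsum (x : ℝ) : ∑' n : ℕ, spectralWeight p x * ((1 + x ^ 2)⁻¹) ^ (n + 1) * z ^ n =
      spectralWeight p x * (√(1 - z) ^ 2 + x ^ 2)⁻¹ := by
    have hx : 0 < 1 + x ^ 2 := by positivity
    have hlt : (1 + x ^ 2)⁻¹ * z < 1 :=
      (mul_le_of_le_one_left hz (inv_one_add_sq_le_one x)).trans_lt hz1
    have hrw (n : ℕ) : spectralWeight p x * ((1 + x ^ 2)⁻¹) ^ (n + 1) * z ^ n =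
        spectralWeight p x * (1 + x ^ 2)⁻¹ * ((1 + x ^ 2)⁻¹ * z) ^ n := by
      rw [mul_pow]; ring
    simp_rw [hrw]
    rw [tsum_mul_left, tsum_geometric_of_lt_one (by positivity) hlt,
      Real.sq_sqrt (by linarith), mul_assoc, ← mul_inv]
    congr 2
    field_simp
    ring
  simp_rw [htsum, integral_spectralWeight_mul_inv hp hq hpz, integral_mul_const] at key
  exact key

theorem analyticAt_LambdaC {a : ℝ} (ha : 0 ≤ a) : AnalyticAt ℂ (LambdaC a) 0 := by
  unfold LambdaC
  have hb : AnalyticAt ℂ (fun z : ℂ => (1 - z) ^ ((1 : ℂ) / 2)) 0 :=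
    (analyticAt_const.sub analyticAt_id).cpow analyticAt_const (by simp)
  refine analyticAt_const.div (analyticAt_const.add (analyticAt_const.mul hb)) ?_
  have : (0 : ℝ) < a + 2 * √2 := by positivity
  simpa using (by exact_mod_cast this.ne' : (a : ℂ) + 2 * (√2 : ℝ) ≠ 0)

theorem LambdaC_ofReal (p : ℝ) {z : ℝ} (hz : z ≤ 1) :
    LambdaC (2 * √2 * p) z = ((1 / (2 * √2 * (p + √(1 - z))) : ℝ) : ℂ) := by
  have h : ((1 : ℂ) - z) ^ ((1 : ℂ) / 2) = ((√(1 - z) : ℝ) : ℂ) := by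
    rw [Real.sqrt_eq_rpow, Complex.ofReal_cpow (by linarith)]
    push_cast
    rfl
  rw [LambdaC, h]
  push_cast
  ring

theorem taylorCoeff_LambdaC {p : ℝ} (hp : 0 ≤ p) (n : ℕ) :
    taylorCoeff (LambdaC (2 * √2 * p)) n =
      ((spectralMoment p n / (2 * √2 * Real.pi) : ℝ) : ℂ) := by
  set m : ℕ → ℂ := fun n => ((spectralMoment p n / (2 * √2 * Real.pi) : ℝ) : ℂ) with hm
  set s := FormalMultilinearSeries.ofScalars ℂ m with hs
  have hrad : (1 : ENNReal) ≤ s.radius := by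
    refine s.le_radius_of_bound (r := 1) (Real.pi / (2 * √2 * Real.pi)) fun k => ?_
    rw [hs, FormalMultilinearSeries.ofScalars_norm, hm, Complex.norm_real,
      Real.norm_of_nonneg (div_nonneg (spectralMoment_nonneg p k) (by positivity))]
    simp only [NNReal.coe_one, one_pow, mul_one]
    gcongr
    exact spectralMoment_le_pi p k
  have hS := (s.hasFPowerSeriesOnBall (one_pos.trans_le hrad)).hasFPowerSeriesAt
  have hF := analyticAt_LambdaC (a := 2 * √2 * p) (by positivity)
  have hreal (z : ℝ) (hz : 0 ≤ z) (hz1 : z < 1) (hpz : p ≠ √(1 - z)) :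
      LambdaC (2 * √2 * p) z = s.sum z := by
    have h := ((hasSum_spectralMoment hp hz hz1 hpz).div_const (2 * √2 * Real.pi))
    have h2 := Complex.hasSum_ofReal.2 h
    rw [LambdaC_ofReal p hz1.le]
    have h3 : s.sum z = ∑' k, m k • (z : ℂ) ^ k :=
      FormalMultilinearSeries.ofScalars_sum_eq m (z : ℂ)
    rw [h3]
    convert! h2.tsum_eq.symm using 1
    · congr 1
      have := Real.pi_ne_zero
      have : p + √(1 - z) ≠ 0 := (add_pos_of_nonneg_of_pos hp (Real.sqrt_pos.2 (by linarith))).ne'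
      field_simp
    · refine tsum_congr fun k => ?_
      simp only [hm, smul_eq_mul]
      push_cast
      ring
  have hfreq : ∃ᶠ z in nhdsWithin (0 : ℂ) {0}ᶜ, LambdaC (2 * √2 * p) z = s.sum z := by
    have hev : ∀ᶠ z : ℝ in nhdsWithin 0 (Ioi 0), LambdaC (2 * √2 * p) z = s.sum z := by
      have h1 : ∀ᶠ z : ℝ in nhdsWithin 0 (Ioi 0), z < 1 :=
        eventually_nhdsWithin_of_eventually_nhds (eventually_lt_nhds one_pos)
      have h2 : ∀ᶠ z : ℝ in nhdsWithin 0 (Ioi 0), z ≠ 1 - p ^ 2 := by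
        rcases eq_or_ne (1 - p ^ 2) 0 with h | h
        · rw [h]
          filter_upwards [self_mem_nhdsWithin] with z hz using ne_of_gt hz
        · exact eventually_nhdsWithin_of_eventually_nhds (eventually_ne_nhds h.symm)
      filter_upwards [h1, h2, self_mem_nhdsWithin] with z hz1 hz2 hz0
      refine hreal z (le_of_lt hz0) hz1 fun h => hz2 ?_
      rw [h, Real.sq_sqrt (by linarith)]
      ring
    have htend : Filter.Tendsto (fun z : ℝ => (z : ℂ)) (nhdsWithin 0 (Ioi 0))
        (nhdsWithin (0 : ℂ) {0}ᶜ) := by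
      refine tendsto_nhdsWithin_iff.2 ⟨?_, ?_⟩
      · exact (Complex.continuous_ofReal.tendsto' 0 0 (by simp)).mono_left nhdsWithin_le_nhds
      · filter_upwards [self_mem_nhdsWithin] with z hz
        simpa using ne_of_gt hz
    exact htend.frequently hev.frequently
  have heq := (hF.frequently_eq_iff_eventually_eq hS.analyticAt).1 hfreq
  have := congrArg (fun q => q.coeff n)
    (hF.hasFPowerSeriesAt.eq_formalMultilinearSeries_of_eventually hS heq)
  simpa only [hs, FormalMultilinearSeries.coeff_ofScalars, hm, taylorCoeff] using this

theorem inv_pow_sub_exp_neg_mem_Icc {n : ℕ} (hn : 1 ≤ n) {u : ℝ} (hu : 0 ≤ u) :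
    ((1 + u / n)⁻¹) ^ n - Real.exp (-u) ∈ Icc 0 (((1 + u / n)⁻¹) ^ n * (u ^ 2 / n)) := by
  have hn0 : (0 : ℝ) < n := by exact_mod_cast hn
  set x := u / n with hx
  have hx0 : 0 ≤ x := by positivity
  have hexp : Real.exp (-u) = Real.exp (-x) ^ n := by
    rw [← Real.exp_nat_mul]
    congr 1
    rw [hx]; field_simp
  have hun : u ^ 2 / n = n * x ^ 2 := by rw [hx]; field_simp
  have hpos : 0 < 1 + x := by positivity
  have hr : 0 < ((1 + x)⁻¹) ^ n := by positivity
  constructor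
  · rw [hexp, sub_nonneg, Real.exp_neg]
    gcongr
    linarith [Real.add_one_le_exp x]
  · have hfac : ((1 + x)⁻¹) ^ n - Real.exp (-u) =
        ((1 + x)⁻¹) ^ n * (1 - ((1 + x) * Real.exp (-x)) ^ n) := by
      rw [hexp, mul_sub, mul_one, ← mul_pow, inv_mul_cancel_left₀ hpos.ne']
    rw [hfac, hun]
    refine mul_le_mul_of_nonneg_left ?_ hr.le
    have hbase : 1 - x ^ 2 ≤ (1 + x) * Real.exp (-x) := by
      nlinarith [Real.add_one_le_exp (-x)]
    by_cases hx1 : x ≤ 1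
    · have h1 : 0 ≤ 1 - x ^ 2 := by nlinarith
      have h2 := one_add_mul_le_pow (a := -x ^ 2) (by nlinarith) n
      have h3 : (1 + -x ^ 2) ^ n ≤ ((1 + x) * Real.exp (-x)) ^ n := by
        gcongr
        linarith
      linarith
    · have h1 : (1 : ℝ) ≤ n := by exact_mod_cast hn
      have h2 : 0 ≤ ((1 + x) * Real.exp (-x)) ^ n := by positivity
      nlinarith

theorem abs_inv_pow_succ_sub_exp_neg_le {n : ℕ} (hn : 1 ≤ n) {u : ℝ} (hu : 0 ≤ u) :
    |((1 + u / n)⁻¹) ^ (n + 1) - Real.exp (-u)| ≤ 54 / n * (1 + u)⁻¹ := by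
  have hn0 : (0 : ℝ) < n := by exact_mod_cast hn
  have hx : 0 ≤ u / n := by positivity
  have hu1 : 0 < 1 + u := by positivity
  have hr1 : (1 + u / n)⁻¹ ≤ 1 := inv_le_one_of_one_le₀ (by linarith)
  have hr0 : 0 < (1 + u / n)⁻¹ := by positivity
  rcases lt_or_ge n 3 with h3 | h3
  · have hexp : Real.exp (-u) ≤ (1 + u)⁻¹ := by
      rw [Real.exp_neg]
      gcongr
      linarith [Real.add_one_le_exp u]
    have hpow : ((1 + u / n)⁻¹) ^ (n + 1) ≤ (1 + u)⁻¹ := by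
      refine (pow_le_pow_of_le_one hr0.le hr1 n.le_succ).trans ?_
      rw [inv_pow]
      gcongr
      have := one_add_mul_le_pow (a := u / n) (by linarith) n
      rwa [mul_div_cancel₀ _ hn0.ne'] at this
    have h54 : (1 : ℝ) ≤ 54 / n := by
      rw [le_div_iff₀ hn0]
      have : (n : ℝ) < 3 := by exact_mod_cast h3
      linarith
    have h1 : (1 + u)⁻¹ ≤ 54 / n * (1 + u)⁻¹ := le_mul_of_one_le_left (by positivity) h54
    rw [abs_le]
    constructor <;> nlinarith [Real.exp_pos (-u), pow_pos hr0 (n + 1)]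
  · have h3' : (3 : ℝ) ≤ n := by exact_mod_cast h3
    have hpow : ((1 + u / n)⁻¹) ^ n ≤ ((1 + u / 3)⁻¹) ^ 3 := by
      rw [inv_pow, inv_pow]
      gcongr
      have h := one_add_mul_self_le_rpow_one_add (s := u / n) (by linarith) (p := n / 3)
        (by linarith)
      have h2 : 1 + u / 3 ≤ (1 + u / n) ^ ((n : ℝ) / 3) := by
        refine le_trans (le_of_eq ?_) h
        field_simp
      calc (1 + u / 3) ^ 3 ≤ ((1 + u / n) ^ ((n : ℝ) / 3)) ^ 3 := by gcongr
        _ = (1 + u / n) ^ n := by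
          rw [← Real.rpow_natCast, ← Real.rpow_mul (by positivity), ← Real.rpow_natCast]
          congr 1
          push_cast
          field_simp
    have hb1 : ((1 + u / 3)⁻¹) ^ 3 * u ^ 2 ≤ 27 * (1 + u)⁻¹ := by
      rw [inv_pow, inv_mul_le_iff₀ (by positivity), ← mul_assoc, ← div_eq_mul_inv,
        le_div_iff₀ hu1]
      nlinarith [pow_nonneg hu 3, pow_nonneg hu 2]
    have hb2 : ((1 + u / 3)⁻¹) ^ 3 * u ≤ 27 * (1 + u)⁻¹ := by
      rw [inv_pow, inv_mul_le_iff₀ (by positivity), ← mul_assoc, ← div_eq_mul_inv,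
        le_div_iff₀ hu1]
      nlinarith [pow_nonneg hu 3, pow_nonneg hu 2]
    obtain ⟨hlo, hhi⟩ := inv_pow_sub_exp_neg_mem_Icc hn hu
    have hstep : ((1 + u / n)⁻¹) ^ n - ((1 + u / n)⁻¹) ^ (n + 1) ∈
        Icc 0 (((1 + u / n)⁻¹) ^ n * (u / n)) := by
      have hfac : ((1 + u / n)⁻¹) ^ n - ((1 + u / n)⁻¹) ^ (n + 1) =
          ((1 + u / n)⁻¹) ^ n * (u / n * (1 + u / n)⁻¹) := by
        rw [pow_succ]
        field_simp
        ring
      rw [hfac]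
      refine ⟨by positivity, ?_⟩
      gcongr
      exact mul_le_of_le_one_right hx hr1
    have hA : ((1 + u / n)⁻¹) ^ n * (u ^ 2 / n) ≤ 27 / n * (1 + u)⁻¹ := by
      calc ((1 + u / n)⁻¹) ^ n * (u ^ 2 / n) ≤ ((1 + u / 3)⁻¹) ^ 3 * (u ^ 2 / n) := by gcongr
        _ = ((1 + u / 3)⁻¹) ^ 3 * u ^ 2 / n := by ring
        _ ≤ 27 * (1 + u)⁻¹ / n := by gcongr
        _ = 27 / n * (1 + u)⁻¹ := by ring
    have hB : ((1 + u / n)⁻¹) ^ n * (u / n) ≤ 27 / n * (1 + u)⁻¹ := by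
      calc ((1 + u / n)⁻¹) ^ n * (u / n) ≤ ((1 + u / 3)⁻¹) ^ 3 * (u / n) := by gcongr
        _ = ((1 + u / 3)⁻¹) ^ 3 * u / n := by ring
        _ ≤ 27 * (1 + u)⁻¹ / n := by gcongr
        _ = 27 / n * (1 + u)⁻¹ := by ring
    have hC : 54 / n * (1 + u)⁻¹ = 27 / n * (1 + u)⁻¹ + 27 / n * (1 + u)⁻¹ := by ring
    rw [abs_le]
    constructor <;> linarith [hstep.1, hstep.2]

/-- The Gaussian average of the spectral weight. -/
def gaussianSpectral (p : ℝ) : ℝ := ∫ y : ℝ, spectralWeight p y * Real.exp (-y ^ 2)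

theorem integrable_exp_neg_sq : Integrable fun y : ℝ => Real.exp (-y ^ 2) := by
  simpa using integrable_exp_neg_mul_sq one_pos

theorem spectralMoment_div_sqrt (p : ℝ) {n : ℕ} (hn : 1 ≤ n) :
    spectralMoment (p / √n) n =
      (√n)⁻¹ * ∫ y : ℝ, spectralWeight p y * ((1 + y ^ 2 / n)⁻¹) ^ (n + 1) := by
  have hn0 : (0 : ℝ) < n := by exact_mod_cast hn
  have hr : 0 < √(n : ℝ) := Real.sqrt_pos.2 hn0
  have h := Measure.integral_comp_div
    (fun x => spectralWeight (p / √n) x * ((1 + x ^ 2)⁻¹) ^ (n + 1)) (√n)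
  simp_rw [spectralWeight_div p _ hr.ne', div_pow, Real.sq_sqrt hn0.le, abs_of_pos hr,
    smul_eq_mul] at h
  rw [h, spectralMoment, inv_mul_cancel_left₀ hr.ne']

theorem abs_spectralMoment_sub_le (p : ℝ) {n : ℕ} (hn : 1 ≤ n) :
    |spectralMoment (p / √n) n - (√n)⁻¹ * gaussianSpectral p| ≤
      54 * Real.pi * ((√n)⁻¹ * (n : ℝ)⁻¹) := by
  have hn0 : (0 : ℝ) < n := by exact_mod_cast hn
  have hr : 0 < √(n : ℝ) := Real.sqrt_pos.2 hn0
  have hint : Integrable fun y : ℝ => ((1 + y ^ 2 / n)⁻¹) ^ (n + 1) := by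
    have h := (integrable_inv_one_add_sq_pow_succ n).comp_div hr.ne'
    simpa only [div_pow, Real.sq_sqrt hn0.le] using h
  rw [spectralMoment_div_sqrt p hn, gaussianSpectral, ← mul_sub, abs_mul,
    abs_of_pos (inv_pos.2 hr), ← integral_sub (Integrable.spectralWeight_mul hint p)
      (Integrable.spectralWeight_mul integrable_exp_neg_sq p)]
  have hbound : |∫ y : ℝ, spectralWeight p y * ((1 + y ^ 2 / n)⁻¹) ^ (n + 1) -
      spectralWeight p y * Real.exp (-y ^ 2)| ≤ ∫ y : ℝ, (54 : ℝ) / n * (1 + y ^ 2)⁻¹ := by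
    rw [← Real.norm_eq_abs]
    refine norm_integral_le_of_norm_le (integrable_inv_one_add_sq.const_mul _)
      (ae_of_all _ fun y => ?_)
    rw [← mul_sub, norm_mul]
    exact (mul_le_of_le_one_left (norm_nonneg _) (abs_spectralWeight_le_one p y)).trans
      (abs_inv_pow_succ_sub_exp_neg_le hn (sq_nonneg y))
  rw [integral_const_mul, integral_univ_inv_one_add_sq] at hbound
  calc _ ≤ (√n)⁻¹ * (54 / n * Real.pi) := by gcongr
    _ = _ := by ring

theorem integral_cexp_mul_gaussian (t : ℝ) :
    ∫ y : ℝ, Complex.exp (Complex.I * ((√2 * t : ℝ) : ℂ) * y) * Complex.exp (-(1 : ℂ) * y ^ 2) =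
      ((√Real.pi * Real.exp (-t ^ 2 / 2) : ℝ) : ℂ) := by
  rw [fourierIntegral_gaussian (b := 1) (by simp), div_one, Real.sqrt_eq_rpow Real.pi]
  push_cast
  rw [Complex.ofReal_cpow Real.pi_pos.le]
  congr 2
  · push_cast; rfl
  · rw [mul_pow, ← Complex.ofReal_pow √2, Real.sq_sqrt zero_le_two]
    push_cast
    ring

theorem integral_laplace_gaussian {p : ℝ} (hp : 0 < p) :
    √Real.pi * ∫ t in Ioi (0 : ℝ), Real.exp (-t ^ 2 / 2) * Real.exp (-(√2 * p) * t) =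
      ∫ y : ℝ, p / (√2 * (p ^ 2 + y ^ 2)) * Real.exp (-y ^ 2) := by
  have h2 : 0 < √2 := by positivity
  set f : ℝ → ℝ → ℂ := fun t y =>
    Complex.exp (Complex.I * ((√2 * t : ℝ) : ℂ) * y) *
      ((Real.exp (-(√2 * p) * t) * Real.exp (-y ^ 2) : ℝ) : ℂ) with hf
  have hint : Integrable (Function.uncurry f) ((volume.restrict (Ioi 0)).prod volume) := by
    have hg : Integrable (fun z : ℝ × ℝ => Real.exp (-(√2 * p) * z.1) * Real.exp (-z.2 ^ 2))
        ((volume.restrict (Ioi 0)).prod volume) :=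
      Integrable.mul_prod (integrableOn_exp_mul_Ioi (by nlinarith) 0) integrable_exp_neg_sq
    refine hg.mono' (Continuous.aestronglyMeasurable (by rw [hf]; unfold Function.uncurry; fun_prop))
      (ae_of_all _ fun z => le_of_eq ?_)
    simp only [hf, Function.uncurry]
    rw [norm_mul, Complex.norm_real, Real.norm_of_nonneg (by positivity), mul_assoc,
      ← Complex.ofReal_mul, mul_comm Complex.I, Complex.norm_exp_ofReal_mul_I, one_mul]
  have hswap := integral_integral_swap hint
  have hleft (t : ℝ) : ∫ y : ℝ, f t y =
      ((√Real.pi * (Real.exp (-t ^ 2 / 2) * Real.exp (-(√2 * p) * t)) : ℝ) : ℂ) := by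
    have h (y : ℝ) : f t y = (Real.exp (-(√2 * p) * t) : ℂ) *
        (Complex.exp (Complex.I * ((√2 * t : ℝ) : ℂ) * y) * Complex.exp (-(1 : ℂ) * y ^ 2)) := by
      simp only [hf]
      push_cast
      rw [neg_one_mul]
      ring
    simp_rw [h]
    rw [integral_const_mul, integral_cexp_mul_gaussian]
    push_cast
    ring
  have hright (y : ℝ) : (∫ t in Ioi (0 : ℝ), f t y) =
      (Real.exp (-y ^ 2) : ℂ) * (1 / (√2 * (p - Complex.I * y))) := by
    have h (t : ℝ) : f t y = (Real.exp (-y ^ 2) : ℂ) *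
        Complex.exp ((√2 * (Complex.I * y - p)) * t) := by
      simp only [hf]
      push_cast
      rw [← mul_assoc, ← Complex.exp_add, mul_comm]
      congr 2
      ring
    simp_rw [h]
    rw [integral_const_mul, integral_exp_mul_complex_Ioi (by simp; nlinarith)]
    congr 1
    have : (√2 : ℂ) * (Complex.I * y - p) = -(√2 * (p - Complex.I * y)) := by ring
    rw [this, neg_div_neg_eq]
    simp
  simp_rw [hleft, hright] at hswap
  rw [integral_complex_ofReal, integral_const_mul] at hswap
  have hre := congrArg Complex.re hswap
  rw [Complex.ofReal_re] at hre
  rw [hre, ← RCLike.re_eq_complex_re, ← integral_re]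
  · refine integral_congr_ae (ae_of_all _ fun y => ?_)
    have hn : (p ^ 2 + y ^ 2 : ℝ) ≠ 0 := by positivity
    have hc : (p : ℂ) - Complex.I * y ≠ 0 := fun h => hp.ne' (by simpa using congrArg Complex.re h)
    have hnc : ((p ^ 2 + y ^ 2 : ℝ) : ℂ) ≠ 0 := by exact_mod_cast hn
    have h2c : (√2 : ℂ) ≠ 0 := by exact_mod_cast h2.ne'
    have hsplit : (1 : ℂ) / (√2 * (p - Complex.I * y)) =
        ((p / (√2 * (p ^ 2 + y ^ 2)) : ℝ) : ℂ) +
          ((y / (√2 * (p ^ 2 + y ^ 2)) : ℝ) : ℂ) * Complex.I := by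
      push_cast at hnc ⊢
      field_simp
      ring_nf
      simp
    simp only [RCLike.re_eq_complex_re]
    rw [hsplit, Complex.re_ofReal_mul, Complex.add_re, Complex.ofReal_re, Complex.re_ofReal_mul,
      Complex.I_re, mul_zero, add_zero, mul_comm]
  · have h := hint.integral_prod_right
    refine h.congr (ae_of_all _ fun y => ?_)
    simp only [Function.uncurry, hright]

theorem integral_mul_gaussian_add (b : ℝ) (hb : 0 ≤ b) :
    (∫ t in Ioi (0 : ℝ), t * Real.exp (-t ^ 2 / 2) * Real.exp (-b * t)) =
      1 - b * ∫ t in Ioi (0 : ℝ), Real.exp (-t ^ 2 / 2) * Real.exp (-b * t) := by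
  have hle {t : ℝ} (ht : t ∈ Ioi (0 : ℝ)) : Real.exp (-b * t) ≤ 1 :=
    Real.exp_le_one_iff.2 (by nlinarith [mem_Ioi.1 ht])
  have h0 : IntegrableOn (fun t => Real.exp (-t ^ 2 / 2) * Real.exp (-b * t)) (Ioi 0) := by
    refine (integrable_exp_neg_mul_sq (b := 1 / 2) (by norm_num)).integrableOn.mono'
      (by fun_prop) ((ae_restrict_iff' measurableSet_Ioi).2 (ae_of_all _ fun t ht => ?_))
    rw [Real.norm_of_nonneg (by positivity)]
    refine (mul_le_of_le_one_right (by positivity) (hle ht)).trans (le_of_eq ?_)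
    congr 1; ring
  have h1 : IntegrableOn (fun t => t * Real.exp (-t ^ 2 / 2) * Real.exp (-b * t)) (Ioi 0) := by
    refine (integrable_mul_exp_neg_mul_sq (b := 1 / 2) (by norm_num)).integrableOn.mono'
      (by fun_prop) ((ae_restrict_iff' measurableSet_Ioi).2 (ae_of_all _ fun t ht => ?_))
    have ht0 : 0 < t := ht
    rw [Real.norm_of_nonneg (by positivity)]
    refine (mul_le_of_le_one_right (by positivity) (hle ht)).trans (le_of_eq ?_)
    congr 2; ring
  have hftc := integral_Ioi_of_hasDerivAt_of_tendsto (a := 0) (m := 0)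
    (f := fun t => -(Real.exp (-t ^ 2 / 2) * Real.exp (-b * t)))
    (f' := fun t => t * Real.exp (-t ^ 2 / 2) * Real.exp (-b * t) +
      b * (Real.exp (-t ^ 2 / 2) * Real.exp (-b * t)))
    (by fun_prop)
    (fun t _ => by
      have e1 : HasDerivAt (fun t : ℝ => -t ^ 2 / 2) (-t) t := by
        convert! ((hasDerivAt_pow 2 t).neg.div_const 2) using 1
        simp; ring
      have e2 : HasDerivAt (fun t : ℝ => -b * t) (-b) t := by
        simpa using (hasDerivAt_id t).const_mul (-b)
      convert! (e1.exp.mul e2.exp).neg using 1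
      ring)
    (h1.add (h0.const_mul b))
    (by
      have hlim : Filter.Tendsto (fun t : ℝ => Real.exp (-t ^ 2 / 2)) Filter.atTop (nhds 0) := by
        refine Real.tendsto_exp_atBot.comp ?_
        simp_rw [neg_div]
        exact Filter.tendsto_neg_atTop_atBot.comp
          ((Filter.tendsto_pow_atTop two_ne_zero).atTop_div_const two_pos)
      rw [← neg_zero]
      refine (squeeze_zero' (Filter.Eventually.of_forall fun t => by positivity) ?_ hlim).neg
      filter_upwards [Filter.eventually_gt_atTop 0] with t ht
      exact mul_le_of_le_one_right (by positivity) (hle ht))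
  rw [integral_add h1 (h0.const_mul b), integral_const_mul] at hftc
  simp at hftc
  simp
  linarith

theorem integral_spectral_gaussian {p : ℝ} (hp : 0 ≤ p) :
    (∫ t in Ioi (0 : ℝ), t * Real.exp (-t ^ 2 / 2) * Real.exp (-(√2 * p) * t)) =
      gaussianSpectral p / √Real.pi := by
  have hpi : 0 < √Real.pi := Real.sqrt_pos.2 Real.pi_pos
  have hgauss : ∫ y : ℝ, Real.exp (-y ^ 2) = √Real.pi := by simpa using integral_gaussian 1
  rw [integral_mul_gaussian_add _ (by positivity)]
  rcases hp.eq_or_lt with rfl | hp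
  · simp [gaussianSpectral, spectralWeight, hgauss, hpi.ne']
  have h := integral_laplace_gaussian hp
  rw [eq_div_iff hpi.ne', sub_mul, one_mul, mul_assoc, mul_comm _ √Real.pi, h,
    ← integral_const_mul, ← hgauss, ← integral_sub integrable_exp_neg_sq]
  · refine integral_congr_ae (ae_of_all _ fun y => ?_)
    have : p ^ 2 + y ^ 2 ≠ 0 := by positivity
    simp only [spectralWeight]
    field_simp
  · have hw := integrable_exp_neg_sq.sub (Integrable.spectralWeight_mul integrable_exp_neg_sq p)
    refine hw.congr (ae_of_all _ fun y => ?_)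
    have : p ^ 2 + y ^ 2 ≠ 0 := by positivity
    simp only [spectralWeight, Pi.sub_apply]
    field_simp
    ring

/-- Asymptotics of the Taylor coefficients `λ_n(k)` of `z ↦ Λ_z(k)`:
`λ_n(k n^{-1/4}) = (8πn)^{-1/2} Â⁽²⁾(k) + O(n^{-3/2})`. -/
theorem lambda_coeff_asymptotics :
    ∀ d : ℕ, ∀ k : Fin d → ℝ, ∃ K : ℝ,
      ∀ n : ℕ, 1 ≤ n →
        ‖taylorCoeff (Lambda (fun i => k i * (n : ℝ) ^ (-(1 : ℝ) / 4))) n -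
            (((8 * Real.pi * n) ^ (-(1 : ℝ) / 2) * AhatTwo k : ℝ) : ℂ)‖ ≤
          K * (n : ℝ) ^ (-(3 : ℝ) / 2) := by
  intro d k
  set A : ℝ := ∑ i, (k i) ^ 2 with hA
  have hA0 : 0 ≤ A := Finset.sum_nonneg fun i _ => sq_nonneg _
  have h2 : 0 < √2 := by positivity
  set p : ℝ := A / (2 * √2) with hp
  have hp0 : 0 ≤ p := by positivity
  have hhat : AhatTwo k = gaussianSpectral p / √Real.pi := by
    rw [← integral_spectral_gaussian hp0, AhatTwo]
    refine integral_congr_ae (ae_of_all _ fun t => ?_)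
    simp only
    congr 2
    rw [← hA, hp]
    field_simp
  refine ⟨54 / (2 * √2), fun n hn => ?_⟩
  have hn0 : (0 : ℝ) < n := by exact_mod_cast hn
  have hr : 0 < √(n : ℝ) := Real.sqrt_pos.2 hn0
  have hpi : 0 < √Real.pi := Real.sqrt_pos.2 Real.pi_pos
  have hpipi : √Real.pi * √Real.pi = Real.pi := Real.mul_self_sqrt Real.pi_pos.le
  have hΛ : Lambda (fun i => k i * (n : ℝ) ^ (-(1 : ℝ) / 4)) = LambdaC (2 * √2 * (p / √n)) := by
    funext z
    rw [Lambda]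
    congr 1
    have hpow : ((n : ℝ) ^ (-(1 : ℝ) / 4)) ^ 2 = (√n)⁻¹ := by
      rw [← Real.rpow_natCast, ← Real.rpow_mul hn0.le, Real.sqrt_eq_rpow, ← Real.rpow_neg hn0.le]
      norm_num
    simp_rw [mul_pow, hpow]
    rw [← Finset.sum_mul, ← hA, hp]
    field_simp
  have hpre : (8 * Real.pi * n) ^ (-(1 : ℝ) / 2) = (2 * √2 * √Real.pi * √n)⁻¹ := by
    have h8 : √(8 : ℝ) = 2 * √2 := by
      rw [show (8 : ℝ) = 2 ^ 2 * 2 by norm_num, Real.sqrt_mul (by norm_num),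
        Real.sqrt_sq zero_le_two]
    rw [neg_div, Real.rpow_neg (by positivity), ← Real.sqrt_eq_rpow,
      Real.sqrt_mul (by positivity), Real.sqrt_mul (by norm_num), h8]
  have hpow : (n : ℝ) ^ (-(3 : ℝ) / 2) = (√n)⁻¹ * (n : ℝ)⁻¹ := by
    rw [Real.sqrt_eq_rpow, ← Real.rpow_neg hn0.le, ← Real.rpow_neg_one (n : ℝ),
      ← Real.rpow_add hn0]
    norm_num
  rw [hΛ, taylorCoeff_LambdaC (by positivity), ← Complex.ofReal_sub, Complex.norm_real, hpre,
    hhat, hpow]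
  have hrw : spectralMoment (p / √n) n / (2 * √2 * Real.pi) -
      (2 * √2 * √Real.pi * √n)⁻¹ * (gaussianSpectral p / √Real.pi) =
      (spectralMoment (p / √n) n - (√n)⁻¹ * gaussianSpectral p) / (2 * √2 * Real.pi) := by
    generalize √Real.pi = s at hpi hpipi
    rw [← hpipi]
    field_simp
  rw [hrw, norm_div, Real.norm_of_nonneg (by positivity : 0 ≤ 2 * √2 * Real.pi),
    div_le_iff₀ (by positivity)]
  refine (abs_spectralMoment_sub_le p hn).trans (le_of_eq ?_)
  field_simp
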